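/- Let k be a positive integer and f(s) = s^{2k} + f_{2k}(s), where f_{2k} : ℝ → ℝ is C^{2k} and f_{2k}(s)/|s|^{2k} → 0 as s → 0. Then there exists ε > 0 (depending on k and f_{2k}) with the following property: if u is a solution of ∂ₜu + ∂ₓ(∂ₓ²u + f(u)) = 0 satisfying the regularity and decay hypotheses that make the virial identity d/dt ∫_ℝ x·u(t,x) dx = ∫_ℝ f(u(t,x)) dx valid (u is C¹ in t, C³ in x; x·u(t,·), f(u(t,·)), ∂ₓ³u(t,·), x·∂ₜu(t,·) integrable; u and its first two x-derivatives, together with x·∂ₓ²u and x·f(u), vanish as |x| → ∞; x·∂ₜu locally uniformly dominated by an integrable function of x), and if sup over t of ‖u(t,·)‖_{H¹} < ε, then u cannot be a nontrivial time periodic solution: if u is periodic in time with some period ω > 0, then u is identically zero. -/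

import Mathlib

open MeasureTheory Filter Topology

/-- A continuous function vanishing at infinity is bounded. -/
lemma Continuous.exists_abs_le_of_tendsto_cocompact {g : ℝ → ℝ} (hg : Continuous g)
    (h0 : Tendsto g (cocompact ℝ) (𝓝 0)) : ∃ C, ∀ x, |g x| ≤ C := by
  let G : ZeroAtInftyContinuousMap ℝ ℝ := ⟨⟨g, hg⟩, h0⟩
  exact ⟨‖G.toBCF‖, fun x => G.toBCF.norm_coe_le_norm x⟩

lemma Continuous.integrable_of_integrable_id_mul {g : ℝ → ℝ} (hg : Continuous g)
    (hi : Integrable fun x => x * g x) : Integrable g := by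
  have hInd : Integrable (Set.indicator (Set.Icc (-1) 1) fun x => |g x|) :=
    (hg.abs.continuousOn.integrableOn_Icc).integrable_indicator measurableSet_Icc
  refine (hi.abs.add hInd).mono' hg.aestronglyMeasurable (Eventually.of_forall fun x => ?_)
  rw [Real.norm_eq_abs]
  simp only [Pi.add_apply, abs_mul]
  by_cases hx : x ∈ Set.Icc (-1 : ℝ) 1
  · rw [Set.indicator_of_mem hx]
    have := mul_nonneg (abs_nonneg x) (abs_nonneg (g x))
    linarith
  · rw [Set.indicator_of_notMem hx]
    have h1 : 1 ≤ |x| := by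
      by_contra! h
      exact hx (abs_le.mp h.le)
    nlinarith [abs_nonneg (g x)]

/-- An integrable `C²` function which vanishes at infinity together with its first two derivatives
has a square integrable derivative. -/
lemma integrable_deriv_sq_of_tendsto {v : ℝ → ℝ} (hv : ContDiff ℝ 2 v) (hi : Integrable v)
    (h0 : Tendsto v (cocompact ℝ) (𝓝 0)) (h1 : Tendsto (deriv v) (cocompact ℝ) (𝓝 0))
    (h2 : Tendsto (deriv (deriv v)) (cocompact ℝ) (𝓝 0)) :
    Integrable fun x => deriv v x ^ 2 := by
  have hv' : ContDiff ℝ 1 (deriv v) := (contDiff_succ_iff_deriv.mp hv).2.2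
  have hv'' : Continuous (deriv (deriv v)) := hv'.continuous_deriv le_rfl
  obtain ⟨C, hC⟩ := hv''.exists_abs_le_of_tendsto_cocompact h2
  obtain ⟨M, hM⟩ := (hv.continuous.mul hv'.continuous).exists_abs_le_of_tendsto_cocompact
    (by rw [← mul_zero (0 : ℝ)]; exact h0.mul h1)
  have hprod : Integrable fun x => v x * deriv (deriv v) x :=
    hi.mul_bdd (c := C) hv''.aestronglyMeasurable (Eventually.of_forall hC)
  refine integrable_of_intervalIntegral_norm_bounded (2 * M + ∫ x, ‖v x * deriv (deriv v) x‖)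
    (fun R => ((hv'.continuous.pow 2).continuousOn.integrableOn_Icc).mono_set
      Set.Ioc_subset_Icc_self)
    tendsto_neg_atTop_atBot tendsto_id ?_
  filter_upwards [eventually_ge_atTop 0] with R hR
  have hparts := intervalIntegral.integral_mul_deriv_eq_deriv_mul (a := -R) (b := R)
    (u := v) (v := deriv v) (u' := deriv v) (v' := deriv (deriv v))
    (fun x _ => (hv.differentiable (by norm_num) x).hasDerivAt)
    (fun x _ => (hv'.differentiable (by norm_num) x).hasDerivAt)
    (hv'.continuous.intervalIntegrable _ _) (hv''.intervalIntegrable _ _)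
  have hle : |∫ x in -R..R, v x * deriv (deriv v) x| ≤ ∫ x, ‖v x * deriv (deriv v) x‖ := by
    rw [intervalIntegral.integral_of_le (by linarith)]
    exact (norm_integral_le_integral_norm _).trans
      (setIntegral_le_integral hprod.norm (Eventually.of_forall fun x => norm_nonneg _))
  have heq : ∫ x in -R..R, ‖deriv v x ^ 2‖ = ∫ x in -R..R, deriv v x * deriv v x := by
    congr 1 with x
    rw [Real.norm_of_nonneg (sq_nonneg _), sq]
  simp only [id, heq]
  have hR1 := abs_le.mp (hM R)
  have hR2 := abs_le.mp (hM (-R))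
  simp only [Pi.mul_apply] at hR1 hR2
  linarith [(abs_le.mp hle).1, hR1.2, hR2.1]

/-- The one-dimensional Sobolev inequality `‖v‖_∞ ≤ ‖v‖_{H¹}`. -/
lemma abs_le_sqrt_integral_sq_add_deriv_sq {v : ℝ → ℝ} (hv : ContDiff ℝ 1 v)
    (h0 : Tendsto v (cocompact ℝ) (𝓝 0)) (hi : Integrable fun x => v x ^ 2 + deriv v x ^ 2)
    (x : ℝ) : |v x| ≤ Real.sqrt (∫ y, (v y ^ 2 + deriv v y ^ 2)) := by
  apply Real.abs_le_sqrt
  have hderiv (y : ℝ) : HasDerivAt (fun z => v z ^ 2) (2 * v y * deriv v y) y := by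
    simpa using ((hv.differentiable one_ne_zero y).hasDerivAt).fun_pow 2
  have hcont : Continuous fun y => 2 * v y * deriv v y :=
    (continuous_const.mul hv.continuous).mul (hv.continuous_deriv le_rfl)
  have hint : Integrable fun y => 2 * v y * deriv v y := by
    refine hi.mono' hcont.aestronglyMeasurable (Eventually.of_forall fun y => ?_)
    rw [Real.norm_eq_abs, abs_le]
    constructor <;> nlinarith [sq_nonneg (v y + deriv v y), sq_nonneg (v y - deriv v y)]
  have hbot : Tendsto (fun y => v y ^ 2) atBot (𝓝 0) := by
    simpa using (h0.mono_left _root_.atBot_le_cocompact).pow 2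
  have hftc := integral_Iic_of_hasDerivAt_of_tendsto' (a := x) (fun y _ => hderiv y)
    hint.integrableOn hbot
  calc v x ^ 2 = ∫ y in Set.Iic x, 2 * v y * deriv v y := by rw [hftc, sub_zero]
    _ ≤ ∫ y in Set.Iic x, (v y ^ 2 + deriv v y ^ 2) :=
        integral_mono hint.integrableOn hi.integrableOn fun y => by
          nlinarith [sq_nonneg (v y - deriv v y)]
    _ ≤ ∫ y, (v y ^ 2 + deriv v y ^ 2) :=
        setIntegral_le_integral hi (Eventually.of_forall fun y => by positivity)

/-- A perturbation of `s ^ (2 * k)` of higher order is positive near `0`, away from `0`. -/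
lemma exists_pos_of_tendsto_div_abs_pow {k : ℕ} {g : ℝ → ℝ}
    (hlim : Tendsto (fun s : ℝ => g s / |s| ^ (2 * k)) (𝓝[≠] 0) (𝓝 0)) :
    ∃ ε > 0, ∀ s : ℝ, s ≠ 0 → |s| < ε → 0 < s ^ (2 * k) + g s := by
  have h := hlim.eventually (lt_mem_nhds (show (-1 : ℝ) < 0 by norm_num))
  rw [eventually_nhdsWithin_iff, Metric.eventually_nhds_iff] at h
  obtain ⟨ε, hε, h⟩ := h
  refine ⟨ε, hε, fun s hs hlt => ?_⟩
  have hpos : 0 < |s| ^ (2 * k) := by positivity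
  have h' := h (by simpa using hlt) hs
  rw [lt_div_iff₀ hpos] at h'
  rw [← (even_two_mul k).pow_abs s]
  linarith

lemma eq_zero_of_tendsto_div_abs_pow {k : ℕ} (hk : 0 < k) {g : ℝ → ℝ} (hg : Continuous g)
    (hlim : Tendsto (fun s : ℝ => g s / |s| ^ (2 * k)) (𝓝[≠] 0) (𝓝 0)) : g 0 = 0 := by
  have hpow : Tendsto (fun s : ℝ => |s| ^ (2 * k)) (𝓝[≠] 0) (𝓝 0) := by
    have hc : Continuous fun s : ℝ => |s| ^ (2 * k) := by fun_prop
    have := hc.tendsto 0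
    simp only [abs_zero, zero_pow (show 2 * k ≠ 0 by omega)] at this
    exact this.mono_left nhdsWithin_le_nhds
  have hmul := hlim.mul hpow
  rw [zero_mul] at hmul
  refine tendsto_nhds_unique ((hg.tendsto 0).mono_left nhdsWithin_le_nhds) (hmul.congr' ?_)
  filter_upwards [self_mem_nhdsWithin] with s hs
  have : |s| ^ (2 * k) ≠ 0 := pow_ne_zero _ (abs_ne_zero.mpr hs)
  field_simp

/-- A periodic function with nonnegative derivative has zero derivative. -/
lemma Function.Periodic.hasDerivAt_eq_zero {I I' : ℝ → ℝ} {ω : ℝ} (hper : Function.Periodic I ω)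
    (hω : 0 < ω) (hI : ∀ t, HasDerivAt I (I' t) t) (hI' : ∀ t, 0 ≤ I' t) (t : ℝ) : I' t = 0 := by
  have hmono : Monotone I := monotone_of_deriv_nonneg (fun t => (hI t).differentiableAt)
    fun t => (hI t).deriv ▸ hI' t
  have hconst (s : ℝ) : I s = I 0 := by
    obtain ⟨y, hy, hys⟩ := hper.exists_mem_Ico₀ hω s
    rw [hys]
    refine le_antisymm ?_ (hmono hy.1)
    have := hmono hy.2.le
    rwa [← zero_add ω, hper 0] at this
  have hd := hI t
  rw [show I = fun _ => I 0 from funext hconst] at hd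
  exact hd.unique (hasDerivAt_const t (I 0))

/-- Integration by parts for the flux `w' + h`: if `x * (w' + h)` and `w` vanish at infinity, then
`∫ x * (w' + h)' = - ∫ h`. -/
lemma integral_id_mul_deriv_flux {w h : ℝ → ℝ} (hw : Differentiable ℝ w)
    (hG : Differentiable ℝ fun x => deriv w x + h x) (hint : Integrable h)
    (hint' : Integrable fun x => x * deriv (fun y => deriv w y + h y) x)
    (hw0 : Tendsto w (cocompact ℝ) (𝓝 0))
    (hw1 : Tendsto (fun x => x * deriv w x) (cocompact ℝ) (𝓝 0))
    (hh : Tendsto (fun x => x * h x) (cocompact ℝ) (𝓝 0)) :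
    ∫ x, x * deriv (fun y => deriv w y + h y) x = - ∫ x, h x := by
  have hderiv (x : ℝ) : HasDerivAt (fun y => y * (deriv w y + h y) - w y)
      (h x + x * deriv (fun y => deriv w y + h y) x) x := by
    refine (((hasDerivAt_id x).mul (hG x).hasDerivAt).sub (hw x).hasDerivAt).congr_deriv ?_
    simp only [id]
    ring
  have hlim : Tendsto (fun y => y * (deriv w y + h y) - w y) (cocompact ℝ) (𝓝 0) := by
    simpa [mul_add] using (hw1.add hh).sub hw0
  have key := integral_of_hasDerivAt_of_tendsto hderiv (hint.add hint')
    (hlim.mono_left _root_.atBot_le_cocompact) (hlim.mono_left _root_.atTop_le_cocompact)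
  rw [integral_add hint hint'] at key
  linarith

/-- For f(s) = s^{2k} + f_{2k}(s) with f_{2k} ∈ C^{2k} and f_{2k}(s)/|s|^{2k} → 0
as s → 0, there is ε > 0 such that no solution of generalized KdV satisfying the
hypotheses making the virial identity valid, and uniformly smaller than ε in H¹,
can be a nontrivial time periodic solution. -/
theorem gkdv_no_small_breather_even
    (k : ℕ) (hk : 0 < k)
    (f2k : ℝ → ℝ) (hf2k : ContDiff ℝ (2 * k : ℕ) f2k)
    (hlim : Tendsto (fun s : ℝ => f2k s / |s| ^ (2 * k)) (𝓝[≠] 0) (𝓝 0))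
    (f : ℝ → ℝ) (hf : ∀ s : ℝ, f s = s ^ (2 * k) + f2k s) :
    ∃ ε > 0, ∀ u : ℝ → ℝ → ℝ,
      (∀ x, ContDiff ℝ 1 (fun t => u t x)) →
      (∀ t, ContDiff ℝ 3 (fun x => u t x)) →
      (∀ t x, deriv (fun s => u s x) t
          + deriv (fun y => deriv (deriv (u t)) y + f (u t y)) x = 0) →
      (∀ t, Integrable (fun x => x * u t x)) →
      (∀ t, Integrable (fun x => f (u t x))) →
      (∀ t, Integrable (fun x => deriv (deriv (deriv (u t))) x)) →
      (∀ t, Integrable (fun x => x * deriv (fun s => u s x) t)) →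
      (∀ t, Tendsto (u t) (cocompact ℝ) (𝓝 0)) →
      (∀ t, Tendsto (deriv (u t)) (cocompact ℝ) (𝓝 0)) →
      (∀ t, Tendsto (deriv (deriv (u t))) (cocompact ℝ) (𝓝 0)) →
      (∀ t, Tendsto (fun x => x * deriv (deriv (u t)) x) (cocompact ℝ) (𝓝 0)) →
      (∀ t, Tendsto (fun x => x * f (u t x)) (cocompact ℝ) (𝓝 0)) →
      (∀ t₀ : ℝ, ∃ g : ℝ → ℝ, Integrable g ∧ ∃ δ > 0, ∀ t, |t - t₀| < δ →
          ∀ x, |x * deriv (fun s => u s x) t| ≤ g x) →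
      (∀ t, Real.sqrt (∫ x, ((u t x) ^ 2 + (deriv (u t) x) ^ 2)) < ε) →
      ∀ ω > 0, (∀ t x, u (t + ω) x = u t x) → ∀ t x, u t x = 0 := by
  obtain ⟨ε, hε, hpos⟩ := exists_pos_of_tendsto_div_abs_pow hlim
  have hf0 : f 0 = 0 := by
    rw [hf, eq_zero_of_tendsto_div_abs_pow hk hf2k.continuous hlim, zero_pow (by omega), add_zero]
  have hfC : ContDiff ℝ 1 f := by
    rw [show f = fun s => s ^ (2 * k) + f2k s from funext hf]
    exact (contDiff_id.pow _).add (hf2k.of_le (by exact_mod_cast (by omega : 1 ≤ 2 * k)))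
  refine ⟨ε, hε, fun u hut hux heq hxu hfu _ hxut hu0 hu1 hu2 hxu2 hxf hdom hsmall ω hω hper => ?_⟩
  have hux1 (t : ℝ) : ContDiff ℝ 2 (deriv (u t)) := (contDiff_succ_iff_deriv.mp (hux t)).2.2
  have hux2 (t : ℝ) : ContDiff ℝ 1 (deriv (deriv (u t))) :=
    (contDiff_succ_iff_deriv.mp (hux1 t)).2.2
  have hbound (t x : ℝ) : |u t x| < ε := by
    obtain ⟨C, hC⟩ := (hux t).continuous.exists_abs_le_of_tendsto_cocompact (hu0 t)
    have hi := (hux t).continuous.integrable_of_integrable_id_mul (hxu t)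
    have hsq : Integrable fun x => u t x ^ 2 := by
      simpa only [sq] using
        hi.mul_bdd (c := C) (hux t).continuous.aestronglyMeasurable (Eventually.of_forall hC)
    have hdsq := integrable_deriv_sq_of_tendsto ((hux t).of_le (by norm_num)) hi
      (hu0 t) (hu1 t) (hu2 t)
    exact (abs_le_sqrt_integral_sq_add_deriv_sq ((hux t).of_le (by norm_num)) (hu0 t)
      (hsq.add hdsq) x).trans_lt (hsmall t)
  have hf_pos (t x : ℝ) (hne : u t x ≠ 0) : 0 < f (u t x) := hf _ ▸ hpos _ hne (hbound t x)
  have hf_nonneg (t x : ℝ) : 0 ≤ f (u t x) := by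
    by_cases h : u t x = 0
    · rw [h, hf0]
    · exact (hf_pos t x h).le
  have hut_eq (t x : ℝ) : deriv (fun s => u s x) t
      = -deriv (fun y => deriv (deriv (u t)) y + f (u t y)) x :=
    eq_neg_of_add_eq_zero_left (heq t x)
  have hvirial (t : ℝ) : HasDerivAt (fun s => ∫ x, x * u s x) (∫ x, f (u t x)) t := by
    obtain ⟨g, hg, δ, hδ, hgb⟩ := hdom t
    have h := (hasDerivAt_integral_of_dominated_loc_of_deriv_le (μ := volume)
      (F := fun s x => x * u s x) (F' := fun s x => x * deriv (fun r => u r x) s)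
      (bound := g) (Metric.ball_mem_nhds t hδ)
      (Eventually.of_forall fun s => (hxu s).aestronglyMeasurable) (hxu t)
      (hxut t).aestronglyMeasurable
      (Eventually.of_forall fun x s hs => hgb s (by simpa [Real.dist_eq] using hs) x) hg
      (Eventually.of_forall fun x s _ =>
        ((hut x).differentiable one_ne_zero s).hasDerivAt.const_mul x)).2
    refine h.congr_deriv ?_
    have hint := hxut t
    simp only [hut_eq, mul_neg] at hint ⊢
    rw [integral_neg, integral_id_mul_deriv_flux (w := deriv (u t)) (h := fun x => f (u t x))
      ((hux1 t).differentiable two_ne_zero)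
      (((hux2 t).differentiable one_ne_zero).add
        ((hfC.differentiable one_ne_zero).comp ((hux t).differentiable three_ne_zero)))
      (hfu t) (by simpa using hint.neg) (hu1 t) (hxu2 t) (hxf t), neg_neg]
  have hzero (t : ℝ) : ∫ x, f (u t x) = 0 :=
    Function.Periodic.hasDerivAt_eq_zero (fun s => by simp only [hper]) hω hvirial
      (fun s => integral_nonneg (hf_nonneg s)) t
  intro t x
  by_contra hne
  have hae := (integral_eq_zero_iff_of_nonneg (hf_nonneg t) (hfu t)).mp (hzero t)
  have hfun := ((hfC.continuous.comp (hux t).continuous).ae_eq_iff_eq volume continuous_zero).mp hae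
  exact (hf_pos t x hne).ne' (congrFun hfun x)
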